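/- Let d be a positive integer, α > 0, M ≥ 0, and let M₀ be a positive integer; set h = α/M₀ and let κ > 0, with t_n ∈ ℝ. Let p : ℝ × ℝ^d → ℝ satisfy |p(t,x) − p(s,y)| ≤ M·(|t − s| + |x − y|) for all t, s ∈ ℝ and x, y ∈ ℝ^d. For each multi-index k ∈ ℤ^d write x^k = h·k, and let values q^k ∈ ℝ (indexed by k with |k_i| ≤ M₀ for all i) satisfy the discrete L² error bound Σ_k |p(t_n, x^k) − q^k|² · h^d ≤ E² for some E ≥ 0. Define the piecewise-constant function p_{κ,h} on (−α,α)^d by p_{κ,h}(y) = q^{k(y)}, where k(y) is the multi-index with components ⌊y_i/h⌋. Then for every s ∈ [t_n, t_n + κ], ∫_{(−α,α)^d} |p(s,y) − p_{κ,h}(y)|² dy ≤ 4·(2α)^d · M² · (κ² + d·h²) + 2·E². -/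

import Mathlib

open MeasureTheory

theorem vol_box_aux (d : ℕ) (s : Fin d → Set ℝ) (hs : ∀ i, MeasurableSet (s i)) :
    MeasurableSet {y : EuclideanSpace ℝ (Fin d) | ∀ i, y i ∈ s i} ∧
    volume {y : EuclideanSpace ℝ (Fin d) | ∀ i, y i ∈ s i} = ∏ i, volume (s i) := by
  have hm : MeasurableSet (Set.univ.pi s) := MeasurableSet.univ_pi hs
  have hpre : {y : EuclideanSpace ℝ (Fin d) | ∀ i, y i ∈ s i}
      = (WithLp.ofLp : EuclideanSpace ℝ (Fin d) → (Fin d → ℝ)) ⁻¹' (Set.univ.pi s) := by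
    ext y; simp
  have hmp := PiLp.volume_preserving_ofLp (Fin d)
  constructor
  · rw [hpre]; exact hmp.measurable hm
  · rw [hpre, hmp.measure_preimage hm.nullMeasurableSet, volume_pi_pi]

theorem numerical_density_L2_error
    (d : ℕ) (hd : 0 < d) (α M : ℝ) (hα : 0 < α) (hM : 0 ≤ M)
    (M₀ : ℕ) (hM₀ : 0 < M₀) (h : ℝ) (hhdef : h = α / M₀)
    (κ tn : ℝ) (hκ : 0 < κ)
    (p : ℝ → EuclideanSpace ℝ (Fin d) → ℝ)
    (hp : ∀ (t s : ℝ) (x y : EuclideanSpace ℝ (Fin d)),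
      |p t x - p s y| ≤ M * (|t - s| + ‖x - y‖))
    (q : (Fin d → ℤ) → ℝ) (E : ℝ) (hE : 0 ≤ E)
    (hq : ∑ k ∈ Fintype.piFinset (fun _ : Fin d => Finset.Icc (-(M₀ : ℤ)) (M₀ : ℤ)),
        |p tn (WithLp.toLp 2 (fun i => h * (k i : ℝ))) - q k| ^ 2 * h ^ d ≤ E ^ 2) :
    ∀ s ∈ Set.Icc tn (tn + κ),
      ∫ y in {y : EuclideanSpace ℝ (Fin d) | ∀ i, y i ∈ Set.Ioo (-α) α},
          |p s y - q (fun i => ⌊y i / h⌋)| ^ 2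
        ≤ 4 * (2 * α) ^ d * M ^ 2 * (κ ^ 2 + d * h ^ 2) + 2 * E ^ 2 := by
  intro s hs
  have hM₀' : (0 : ℝ) < M₀ := by exact_mod_cast hM₀
  have hh : 0 < h := by rw [hhdef]; positivity
  have hαh : α = h * M₀ := by rw [hhdef]; field_simp
  set S := Fintype.piFinset (fun _ : Fin d => Finset.Icc (-(M₀ : ℤ)) (M₀ : ℤ)) with hS
  set a : (Fin d → ℤ) → ℝ :=
    fun k => |p tn (WithLp.toLp 2 (fun i => h * (k i : ℝ))) - q k| ^ 2 with ha
  set B : Set (EuclideanSpace ℝ (Fin d)) := {y | ∀ i, y i ∈ Set.Ioo (-α) α} with hB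
  let C : (Fin d → ℤ) → Set (EuclideanSpace ℝ (Fin d)) :=
    fun k => {y | ∀ i, y i ∈ Set.Ico (h * (k i : ℝ)) (h * (k i + 1))}
  obtain ⟨hBm, hBv⟩ := vol_box_aux d (fun _ => Set.Ioo (-α) α) (fun _ => measurableSet_Ioo)
  have hC := fun k : Fin d → ℤ => vol_box_aux d
    (fun i => Set.Ico (h * (k i : ℝ)) (h * (k i + 1))) (fun _ => measurableSet_Ico)
  have hBv' : volume B = ENNReal.ofReal ((2 * α) ^ d) := by
    rw [hB, hBv]
    simp only [Real.volume_Ioo, Finset.prod_const, Finset.card_univ, Fintype.card_fin]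
    rw [← ENNReal.ofReal_pow (by linarith)]
    congr 2; ring
  have hCv : ∀ k, volume (C k) = ENNReal.ofReal (h ^ d) := by
    intro k
    refine (hC k).2.trans ?_
    have : ∀ x : ℝ, h * (x + 1) - h * x = h := fun x => by ring
    simp only [Real.volume_Ico, this, Finset.prod_const, Finset.card_univ, Fintype.card_fin]
    rw [← ENNReal.ofReal_pow hh.le]
  have hCm : ∀ k, MeasurableSet (C k) := fun k => (hC k).1
  have ha0 : ∀ k, 0 ≤ a k := fun k => by simp only [ha]; positivity
  set c : ℝ := 4 * M ^ 2 * (κ ^ 2 + d * h ^ 2) with hc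
  have hpt : ∀ y ∈ B, |p s y - q (fun i => ⌊y i / h⌋)| ^ 2
      ≤ c + ∑ k ∈ S, (C k).indicator (fun _ => 2 * a k) y := by
    intro y hy
    set k : Fin d → ℤ := fun i => ⌊y i / h⌋ with hk
    have hlow : ∀ i, h * (k i : ℝ) ≤ y i := fun i => by
      have := Int.floor_le (y i / h)
      rw [le_div_iff₀ hh] at this
      simp only [hk]; linarith
    have hup : ∀ i, y i < h * (k i + 1) := fun i => by
      have := Int.lt_floor_add_one (y i / h)
      rw [div_lt_iff₀ hh] at this
      simp only [hk]; linarith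
    have hkS : k ∈ S := by
      rw [hS, Fintype.mem_piFinset]
      intro i
      have h1 := (hy i).1
      have h2 := (hy i).2
      rw [Finset.mem_Icc]
      constructor
      · apply Int.le_floor.2
        rw [le_div_iff₀ hh]; push_cast; nlinarith
      · have : (k i : ℝ) < M₀ := by
          have h3 := hlow i
          rw [hαh] at h2
          exact lt_of_mul_lt_mul_left (h3.trans_lt h2) hh.le
        exact_mod_cast this.le
    have hkC : y ∈ C k := fun i => ⟨hlow i, hup i⟩
    have hsum : 2 * a k ≤ ∑ k ∈ S, (C k).indicator (fun _ => 2 * a k) y := by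
      have := Finset.single_le_sum (f := fun k => (C k).indicator (fun _ => 2 * a k) y)
        (s := S) (fun j _ => Set.indicator_nonneg (fun _ _ => by linarith [ha0 j]) y) hkS
      simpa only [Set.indicator_of_mem hkC] using this
    set x : EuclideanSpace ℝ (Fin d) := WithLp.toLp 2 (fun i => h * (k i : ℝ)) with hx
    have hnorm : ‖y - x‖ ^ 2 ≤ d * h ^ 2 := by
      rw [EuclideanSpace.norm_sq_eq]
      calc _ ≤ ∑ i : Fin d, h ^ 2 := by
            apply Finset.sum_le_sum
            intro i _
            have h1 := hlow i
            have h2 := hup i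
            rw [Real.norm_eq_abs, sq_abs]
            simp only [hx, PiLp.sub_apply]
            apply pow_le_pow_left₀ <;> linarith
        _ = _ := by simp
    have hts : |s - tn| ≤ κ := by
      rw [abs_le]; constructor <;> linarith [hs.1, hs.2]
    have h1 : |p s y - p tn x| ^ 2 ≤ 2 * M ^ 2 * (κ ^ 2 + d * h ^ 2) := by
      calc _ ≤ (M * (|s - tn| + ‖y - x‖)) ^ 2 :=
            pow_le_pow_left₀ (abs_nonneg _) (hp s tn y x) 2
        _ = M ^ 2 * (|s - tn| + ‖y - x‖) ^ 2 := by ring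
        _ ≤ M ^ 2 * (2 * (κ ^ 2 + d * h ^ 2)) := by
            gcongr
            have := pow_le_pow_left₀ (abs_nonneg _) hts 2
            nlinarith [sq_nonneg (|s - tn| - ‖y - x‖)]
        _ = _ := by ring
    have h2 : |p s y - q k| ^ 2 ≤ 2 * |p s y - p tn x| ^ 2 + 2 * a k := by
      simp only [ha, ← hx, sq_abs]
      nlinarith [sq_nonneg ((p s y - p tn x) - (p tn x - q k))]
    linarith
  have hBfin : volume B ≠ ⊤ := by rw [hBv']; exact ENNReal.ofReal_ne_top
  have : IsFiniteMeasure (volume.restrict B) := ⟨by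
    rw [Measure.restrict_apply_univ]; exact hBfin.lt_top⟩
  have hI : ∀ k ∈ S, Integrable ((C k).indicator (fun _ => 2 * a k)) (volume.restrict B) :=
    fun k _ => (integrable_const _).indicator (hCm k)
  calc _ ≤ ∫ y in B, (c + ∑ k ∈ S, (C k).indicator (fun _ => 2 * a k) y) := by
        apply integral_mono_of_nonneg
        · exact Filter.Eventually.of_forall fun y => by simp only [Pi.zero_apply]; positivity
        · exact (integrable_const c).add (integrable_finsetSum _ hI)
        · exact (ae_restrict_iff' hBm).2 (Filter.Eventually.of_forall hpt)
    _ = (2 * α) ^ d * c + ∑ k ∈ S, (volume.restrict B).real (C k) * (2 * a k) := by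
        rw [integral_add (integrable_const c) (integrable_finsetSum _ hI),
          integral_finsetSum _ hI]
        congr 1
        · rw [setIntegral_const, measureReal_def, hBv',
            ENNReal.toReal_ofReal (by positivity), smul_eq_mul]
        · refine Finset.sum_congr rfl fun k _ => ?_
          rw [integral_indicator_const _ (hCm k), smul_eq_mul]
    _ ≤ (2 * α) ^ d * c + ∑ k ∈ S, 2 * (a k * h ^ d) := by
        refine add_le_add le_rfl (Finset.sum_le_sum fun k _ => ?_)
        have : (volume.restrict B).real (C k) ≤ h ^ d := by
          rw [measureReal_def]
          apply ENNReal.toReal_le_of_le_ofReal (by positivity)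
          rw [← hCv k]
          exact Measure.restrict_apply_le _ _
        nlinarith [ha0 k]
    _ ≤ _ := by
        rw [← Finset.mul_sum]
        have : (2 * α) ^ d * c = 4 * (2 * α) ^ d * M ^ 2 * (κ ^ 2 + d * h ^ 2) := by
          rw [hc]; ring
        linarith
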